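/- arXiv:1511.02185 — 3 statements merged into one kernel-verified Lean document; each statement's English description precedes it below -/
import Mathlib

section
/- Let O ⊆ ℝⁿ be open, T > 0, and u : O × (0,T) → ℝ be continuous. Let φ : ℝ × [0,T) → ℝ be C^{2,1} with ∂_r φ ≥ 0 (derivative in the first variable), and let Ψ : ℝ × [0,T) → ℝ satisfy φ(Ψ(u(y,t),t),t) = u(y,t) for all (y,t) ∈ O × (0,T) and Ψ(φ(r,t),t) = r for all r in the range of Ψ(u(·,t),t). If (τ, p, X) ∈ P^{2,+} of the function (y,t) ↦ Ψ(u(y,t),t) at a point (y₀,t₀) ∈ O × (0,T), then (φ_t + φ′τ, φ′p, φ″ p⊗p + φ′X) ∈ P^{2,+} u(y₀,t₀), where φ_t, φ′, φ″ denote the t-derivative and the first and second derivatives of φ in its first variable, all evaluated at (Ψ(u(y₀,t₀),t₀), t₀). -/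
open Set Filter Topology

/-- The parabolic second-order superjet `P^{2,+} u (z)` of `u` at a point `z` of the
parabolic domain `O × (0,T)`: triples `(∂ₜφ(z), Dφ(z), D²φ(z))` where `φ` is `C^{2,1}`
on `O × (0,T)` (once continuously differentiable in `t`, twice continuously
differentiable in `x`) and `u − φ` attains a local maximum at `z`. -/
def ParabolicSuperjet {n : ℕ} (O : Set (EuclideanSpace ℝ (Fin n))) (T : ℝ)
    (u : EuclideanSpace ℝ (Fin n) × ℝ → ℝ) (z : EuclideanSpace ℝ (Fin n) × ℝ) :
    Set (ℝ × (EuclideanSpace ℝ (Fin n) →L[ℝ] ℝ) ×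
      (EuclideanSpace ℝ (Fin n) →L[ℝ] EuclideanSpace ℝ (Fin n) →L[ℝ] ℝ)) :=
  {j | ∃ (φ φt : EuclideanSpace ℝ (Fin n) × ℝ → ℝ)
      (Dφ : EuclideanSpace ℝ (Fin n) × ℝ → (EuclideanSpace ℝ (Fin n) →L[ℝ] ℝ))
      (D2φ : EuclideanSpace ℝ (Fin n) × ℝ →
        (EuclideanSpace ℝ (Fin n) →L[ℝ] EuclideanSpace ℝ (Fin n) →L[ℝ] ℝ)),
    (∀ w ∈ O ×ˢ Ioo (0 : ℝ) T, HasDerivAt (fun s => φ (w.1, s)) (φt w) w.2) ∧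
    (∀ w ∈ O ×ˢ Ioo (0 : ℝ) T, HasFDerivAt (fun x => φ (x, w.2)) (Dφ w) w.1) ∧
    (∀ w ∈ O ×ˢ Ioo (0 : ℝ) T, HasFDerivAt (fun x => Dφ (x, w.2)) (D2φ w) w.1) ∧
    ContinuousOn φt (O ×ˢ Ioo (0 : ℝ) T) ∧
    ContinuousOn Dφ (O ×ˢ Ioo (0 : ℝ) T) ∧
    ContinuousOn D2φ (O ×ˢ Ioo (0 : ℝ) T) ∧
    IsLocalMax (fun w => u w - φ w) z ∧
    j = (φt z, Dφ z, D2φ z)}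

/-- A function on an open subset of `E × ℝ` with continuous partial derivatives is strictly
differentiable. -/
theorem hasStrictFDerivAt_of_continuousOn_partial {E : Type*} [NormedAddCommGroup E]
    [NormedSpace ℝ E] {S : Set (E × ℝ)} (hS : IsOpen S) {f ft : E × ℝ → ℝ}
    {Df : E × ℝ → (E →L[ℝ] ℝ)}
    (ht : ∀ w ∈ S, HasDerivAt (fun s => f (w.1, s)) (ft w) w.2)
    (hx : ∀ w ∈ S, HasFDerivAt (fun x => f (x, w.2)) (Df w) w.1)
    (hct : ContinuousOn ft S) (hcx : ContinuousOn Df S) {w : E × ℝ} (hw : w ∈ S) :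
    HasStrictFDerivAt f
      ((Df w).coprod (ContinuousLinearMap.toSpanSingleton ℝ (ft w))) w := by
  have hmem := hS.mem_nhds hw
  refine hasStrictFDerivAt_uncurry_coprod (f := fun x s => f (x, s))
    (f₁ := fun x s => Df (x, s))
    (f₂ := fun x s => ContinuousLinearMap.toSpanSingleton ℝ (ft (x, s))) ?_ ?_ ?_ ?_
  · filter_upwards [hmem] with v hv using hx v hv
  · filter_upwards [hmem] with v hv using (ht v hv).hasFDerivAt
  · exact hcx.continuousAt hmem
  · exact (ContinuousLinearMap.toSpanSingletonCLE (𝕜 := ℝ) (E := ℝ)).continuous.continuousAt.comp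
      (hct.continuousAt hmem)

/-- Let `O ⊆ ℝⁿ` be open, `T > 0`, `u` continuous on `O × (0,T)`.
Let `φ : ℝ × [0,T) → ℝ` be `C^{2,1}` with `∂ᵣφ ≥ 0`, and `Ψ` satisfy
`φ(Ψ(u(y,t),t),t) = u(y,t)` on `O × (0,T)` and `Ψ(φ(r,t),t) = r` for `r` in the range
of `Ψ(u(·,t),t)`.  If `(τ,p,X) ∈ P^{2,+}` of `(y,t) ↦ Ψ(u(y,t),t)` at
`(y₀,t₀) ∈ O × (0,T)`, then
`(φₜ + φ′τ, φ′p, φ″ p⊗p + φ′X) ∈ P^{2,+} u (y₀,t₀)`, derivatives of `φ` evaluated at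
`(Ψ(u(y₀,t₀),t₀), t₀)`. -/
theorem superjet_comp_increasing (n : ℕ)
    (O : Set (EuclideanSpace ℝ (Fin n))) (hO : IsOpen O) (T : ℝ) (hT : 0 < T)
    (u : EuclideanSpace ℝ (Fin n) × ℝ → ℝ) (hu : ContinuousOn u (O ×ˢ Ioo 0 T))
    (φ φt φr φrr : ℝ × ℝ → ℝ) (Ψ : ℝ × ℝ → ℝ)
    (hφt : ∀ r : ℝ, ∀ t ∈ Ico (0 : ℝ) T,
      HasDerivWithinAt (fun s => φ (r, s)) (φt (r, t)) (Ico 0 T) t)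
    (hφr : ∀ r : ℝ, ∀ t ∈ Ico (0 : ℝ) T, HasDerivAt (fun ρ => φ (ρ, t)) (φr (r, t)) r)
    (hφrr : ∀ r : ℝ, ∀ t ∈ Ico (0 : ℝ) T, HasDerivAt (fun ρ => φr (ρ, t)) (φrr (r, t)) r)
    (hφc : ContinuousOn φ (univ ×ˢ Ico 0 T))
    (hφtc : ContinuousOn φt (univ ×ˢ Ico 0 T))
    (hφrc : ContinuousOn φr (univ ×ˢ Ico 0 T))
    (hφrrc : ContinuousOn φrr (univ ×ˢ Ico 0 T))
    (hmono : ∀ r : ℝ, ∀ t ∈ Ico (0 : ℝ) T, 0 ≤ φr (r, t))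
    (hinv : ∀ y ∈ O, ∀ t ∈ Ioo (0 : ℝ) T, φ (Ψ (u (y, t), t), t) = u (y, t))
    (hinv' : ∀ t ∈ Ioo (0 : ℝ) T, ∀ r : ℝ,
      (∃ y ∈ O, r = Ψ (u (y, t), t)) → Ψ (φ (r, t), t) = r)
    (y₀ : EuclideanSpace ℝ (Fin n)) (t₀ : ℝ) (hy₀ : y₀ ∈ O) (ht₀ : t₀ ∈ Ioo 0 T)
    (τ : ℝ) (p : EuclideanSpace ℝ (Fin n) →L[ℝ] ℝ)
    (X : EuclideanSpace ℝ (Fin n) →L[ℝ] EuclideanSpace ℝ (Fin n) →L[ℝ] ℝ)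
    (hjet : (τ, p, X) ∈ ParabolicSuperjet O T (fun w => Ψ (u w, w.2)) (y₀, t₀)) :
    (φt (Ψ (u (y₀, t₀), t₀), t₀) + φr (Ψ (u (y₀, t₀), t₀), t₀) * τ,
      φr (Ψ (u (y₀, t₀), t₀), t₀) • p,
      φrr (Ψ (u (y₀, t₀), t₀), t₀) • p.smulRight p
        + φr (Ψ (u (y₀, t₀), t₀), t₀) • X)
      ∈ ParabolicSuperjet O T u (y₀, t₀) := by
  obtain ⟨ψ, ψt, Dψ, D2ψ, hψt, hψx, hψxx, hct, hcx, hcxx, hmax, hj⟩ := hjet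
  obtain ⟨rfl, rfl, rfl⟩ : τ = ψt (y₀, t₀) ∧ p = Dψ (y₀, t₀) ∧ X = D2ψ (y₀, t₀) := by
    simpa [Prod.ext_iff] using hj
  set c : ℝ := Ψ (u (y₀, t₀), t₀) - ψ (y₀, t₀) with hc
  have hcz : ψ (y₀, t₀) + c = Ψ (u (y₀, t₀), t₀) := by rw [hc]; ring
  have hS : IsOpen (O ×ˢ Ioo (0 : ℝ) T) := hO.prod isOpen_Ioo
  have hU : IsOpen ((univ : Set ℝ) ×ˢ Ioo (0 : ℝ) T) := isOpen_univ.prod isOpen_Ioo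
  have hsub : (univ : Set ℝ) ×ˢ Ioo (0 : ℝ) T ⊆ univ ×ˢ Ico 0 T :=
    prod_mono_right Ioo_subset_Ico_self
  have hψc : ContinuousOn ψ (O ×ˢ Ioo (0 : ℝ) T) := fun w hw =>
    (hasStrictFDerivAt_of_continuousOn_partial hS hψt hψx hct hcx hw).continuousAt
      |>.continuousWithinAt
  have hφd : ∀ w ∈ (univ : Set ℝ) ×ˢ Ioo (0 : ℝ) T, HasFDerivAt φ
      ((ContinuousLinearMap.toSpanSingleton ℝ (φr w)).coprod
        (ContinuousLinearMap.toSpanSingleton ℝ (φt w))) w := fun w hw =>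
    (hasStrictFDerivAt_of_continuousOn_partial
      (Df := fun w => ContinuousLinearMap.toSpanSingleton ℝ (φr w)) hU
      (fun v hv => (hφt v.1 v.2 (Ioo_subset_Ico_self hv.2)).hasDerivAt
        (Ico_mem_nhds hv.2.1 hv.2.2))
      (fun v hv => (hφr v.1 v.2 (Ioo_subset_Ico_self hv.2)).hasFDerivAt)
      (hφtc.mono hsub)
      ((ContinuousLinearMap.toSpanSingletonCLE (𝕜 := ℝ) (E := ℝ)).continuous.comp_continuousOn
        (hφrc.mono hsub)) hw).hasFDerivAt
  let g : EuclideanSpace ℝ (Fin n) × ℝ → ℝ × ℝ := fun w => (ψ w + c, w.2)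
  have hgc : ContinuousOn g (O ×ˢ Ioo (0 : ℝ) T) :=
    (hψc.add continuousOn_const).prodMk continuousOn_snd
  have hgm : MapsTo g (O ×ˢ Ioo (0 : ℝ) T) (univ ×ˢ Ico 0 T) := fun w hw =>
    ⟨mem_univ _, Ioo_subset_Ico_self hw.2⟩
  have hφr_g := hφrc.comp hgc hgm
  have hφrr_g := hφrrc.comp hgc hgm
  have hφt_g := hφtc.comp hgc hgm
  refine ⟨fun w => φ (g w), fun w => φt (g w) + φr (g w) * ψt w, fun w => φr (g w) • Dψ w,
    fun w => φrr (g w) • (Dψ w).smulRight (Dψ w) + φr (g w) • D2ψ w,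
    fun w hw => ?_, fun w hw => ?_, fun w hw => ?_, ?_, ?_, ?_, ?_, ?_⟩
  · have h := (hφd (g w) ⟨mem_univ _, hw.2⟩).comp_hasDerivAt
      (f := fun s => (ψ (w.1, s) + c, s)) w.2 (((hψt w hw).add_const c).prodMk (hasDerivAt_id w.2))
    refine h.congr_deriv ?_
    simp
    ring
  · exact (hφr (ψ w + c) w.2 (Ioo_subset_Ico_self hw.2)).comp_hasFDerivAt w.1
      ((hψx w hw).add_const c)
  · have h := ((hφrr (ψ w + c) w.2 (Ioo_subset_Ico_self hw.2)).comp_hasFDerivAt w.1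
      ((hψx w hw).add_const c)).smul (hψxx w hw)
    refine h.congr_fderiv ?_
    ext x y
    simp [g]
    ring
  · exact hφt_g.add (hφr_g.mul hct)
  · exact hφr_g.smul hcx
  · have hpp := ((ContinuousLinearMap.smulRightL ℝ (EuclideanSpace ℝ (Fin n))
      (EuclideanSpace ℝ (Fin n) →L[ℝ] ℝ)).continuous.comp_continuousOn hcx).clm_apply hcx
    exact (hφrr_g.smul hpp).add (hφr_g.smul hcxx)
  · filter_upwards [hmax, hS.mem_nhds ⟨hy₀, ht₀⟩] with w hw hwS
    have hmono' : Monotone fun ρ => φ (ρ, w.2) := by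
      have hd := fun r => hφr r w.2 (Ioo_subset_Ico_self hwS.2)
      refine monotone_of_deriv_nonneg (fun r => (hd r).differentiableAt) fun r => ?_
      rw [(hd r).deriv]
      exact hmono r w.2 (Ioo_subset_Ico_self hwS.2)
    have hle : Ψ (u w, w.2) ≤ ψ w + c := by
      linarith
    have h1 : φ (Ψ (u w, w.2), w.2) ≤ φ (ψ w + c, w.2) := hmono' hle
    have h2 : φ (Ψ (u w, w.2), w.2) = u w := hinv w.1 hwS.1 w.2 hwS.2
    have h3 := hinv y₀ hy₀ t₀ ht₀
    simp only [g, hcz, h3]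
    linarith
  · simp only [g, hcz]
end

section
/- Let O ⊆ ℝⁿ be open, T > 0, and u : O × (0,T) → ℝ be continuous. Let φ : ℝ × [0,T) → ℝ be C^{2,1} with ∂_r φ ≥ 0 (derivative in the first variable), and let Ψ : ℝ × [0,T) → ℝ satisfy φ(Ψ(u(y,t),t),t) = u(y,t) for all (y,t) ∈ O × (0,T) and Ψ(φ(r,t),t) = r for all r in the range of Ψ(u(·,t),t). If (τ, p, X) ∈ P^{2,−} of the function (y,t) ↦ Ψ(u(y,t),t) at a point (y₀,t₀) ∈ O × (0,T), then (φ_t + φ′τ, φ′p, φ″ p⊗p + φ′X) ∈ P^{2,−} u(y₀,t₀), where φ_t, φ′, φ″ denote the t-derivative and the first and second derivatives of φ in its first variable, all evaluated at (Ψ(u(y₀,t₀),t₀), t₀). -/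
open Set Filter Topology

/-- The parabolic second-order subjet `P^{2,-} u (z) := -P^{2,+}(-u)(z)`. -/
def ParabolicSubjet {n : ℕ} (O : Set (EuclideanSpace ℝ (Fin n))) (T : ℝ)
    (u : EuclideanSpace ℝ (Fin n) × ℝ → ℝ) (z : EuclideanSpace ℝ (Fin n) × ℝ) :
    Set (ℝ × (EuclideanSpace ℝ (Fin n) →L[ℝ] ℝ) ×
      (EuclideanSpace ℝ (Fin n) →L[ℝ] EuclideanSpace ℝ (Fin n) →L[ℝ] ℝ)) :=
  {j | (-j.1, -j.2.1, -j.2.2) ∈ ParabolicSuperjet O T (fun w => -u w) z}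

/-- A function of space and time with a space derivative and a time derivative near a point, both
continuous at that point, is strictly differentiable there. -/
theorem hasStrictFDerivAt_of_space_time {E : Type*} [NormedAddCommGroup E] [NormedSpace ℝ E]
    {f ft : E × ℝ → ℝ} {Df : E × ℝ → (E →L[ℝ] ℝ)} {w : E × ℝ}
    (hx : ∀ᶠ v in 𝓝 w, HasFDerivAt (fun x => f (x, v.2)) (Df v) v.1)
    (ht : ∀ᶠ v in 𝓝 w, HasDerivAt (fun s => f (v.1, s)) (ft v) v.2)
    (hDf : ContinuousAt Df w) (hft : ContinuousAt ft w) :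
    HasStrictFDerivAt f ((Df w).coprod (ContinuousLinearMap.toSpanSingleton ℝ (ft w))) w := by
  have h := hasStrictFDerivAt_uncurry_coprod (𝕜 := ℝ) (u := w) (f := fun x t => f (x, t))
    (f₁ := fun x t => Df (x, t))
    (f₂ := fun x t => ContinuousLinearMap.toSpanSingleton ℝ (ft (x, t))) hx
    (ht.mono fun v hv => hv.hasFDerivAt) hDf
    ((ContinuousLinearMap.toSpanSingletonCLE (𝕜 := ℝ) (E := ℝ)).continuous.continuousAt.comp hft)
  exact h

/-- The chain rule in time for `φ (g s, s)`. -/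
theorem hasDerivAt_comp_space_time {φ φr φt : ℝ × ℝ → ℝ} {g : ℝ → ℝ} {g' t : ℝ}
    (hr : ∀ᶠ v in 𝓝 (g t, t), HasDerivAt (fun ρ => φ (ρ, v.2)) (φr v) v.1)
    (ht : ∀ᶠ v in 𝓝 (g t, t), HasDerivAt (fun s => φ (v.1, s)) (φt v) v.2)
    (hφr : ContinuousAt φr (g t, t)) (hφt : ContinuousAt φt (g t, t))
    (hg : HasDerivAt g g' t) :
    HasDerivAt (fun s => φ (g s, s)) (φr (g t, t) * g' + φt (g t, t)) t := by
  have h := hasStrictFDerivAt_of_space_time (f := φ) (ft := φt)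
    (Df := fun v => ContinuousLinearMap.toSpanSingleton ℝ (φr v))
    (hr.mono fun v hv => hv.hasFDerivAt) ht
    ((ContinuousLinearMap.toSpanSingletonCLE (𝕜 := ℝ) (E := ℝ)).continuous.continuousAt.comp hφr)
    hφt
  have h' := h.hasFDerivAt.comp_hasDerivAt_of_eq t (hg.prodMk (hasDerivAt_id t)) rfl
  refine h'.congr_deriv ?_
  simp [mul_comm]

/-- Let `O ⊆ ℝⁿ` be open, `T > 0`, `u` continuous on `O × (0,T)`.
Let `φ : ℝ × [0,T) → ℝ` be `C^{2,1}` with `∂ᵣφ ≥ 0`, and `Ψ` satisfy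
`φ(Ψ(u(y,t),t),t) = u(y,t)` on `O × (0,T)` and `Ψ(φ(r,t),t) = r` for `r` in the range
of `Ψ(u(·,t),t)`.  If `(τ,p,X) ∈ P^{2,-}` of `(y,t) ↦ Ψ(u(y,t),t)` at
`(y₀,t₀) ∈ O × (0,T)`, then
`(φₜ + φ′τ, φ′p, φ″ p⊗p + φ′X) ∈ P^{2,-} u (y₀,t₀)`, derivatives of `φ` evaluated at
`(Ψ(u(y₀,t₀),t₀), t₀)`. -/
theorem subjet_comp_increasing (n : ℕ)
    (O : Set (EuclideanSpace ℝ (Fin n))) (hO : IsOpen O) (T : ℝ) (hT : 0 < T)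
    (u : EuclideanSpace ℝ (Fin n) × ℝ → ℝ) (hu : ContinuousOn u (O ×ˢ Ioo 0 T))
    (φ φt φr φrr : ℝ × ℝ → ℝ) (Ψ : ℝ × ℝ → ℝ)
    (hφt : ∀ r : ℝ, ∀ t ∈ Ico (0 : ℝ) T,
      HasDerivWithinAt (fun s => φ (r, s)) (φt (r, t)) (Ico 0 T) t)
    (hφr : ∀ r : ℝ, ∀ t ∈ Ico (0 : ℝ) T, HasDerivAt (fun ρ => φ (ρ, t)) (φr (r, t)) r)
    (hφrr : ∀ r : ℝ, ∀ t ∈ Ico (0 : ℝ) T, HasDerivAt (fun ρ => φr (ρ, t)) (φrr (r, t)) r)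
    (hφc : ContinuousOn φ (univ ×ˢ Ico 0 T))
    (hφtc : ContinuousOn φt (univ ×ˢ Ico 0 T))
    (hφrc : ContinuousOn φr (univ ×ˢ Ico 0 T))
    (hφrrc : ContinuousOn φrr (univ ×ˢ Ico 0 T))
    (hmono : ∀ r : ℝ, ∀ t ∈ Ico (0 : ℝ) T, 0 ≤ φr (r, t))
    (hinv : ∀ y ∈ O, ∀ t ∈ Ioo (0 : ℝ) T, φ (Ψ (u (y, t), t), t) = u (y, t))
    (hinv' : ∀ t ∈ Ioo (0 : ℝ) T, ∀ r : ℝ,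
      (∃ y ∈ O, r = Ψ (u (y, t), t)) → Ψ (φ (r, t), t) = r)
    (y₀ : EuclideanSpace ℝ (Fin n)) (t₀ : ℝ) (hy₀ : y₀ ∈ O) (ht₀ : t₀ ∈ Ioo 0 T)
    (τ : ℝ) (p : EuclideanSpace ℝ (Fin n) →L[ℝ] ℝ)
    (X : EuclideanSpace ℝ (Fin n) →L[ℝ] EuclideanSpace ℝ (Fin n) →L[ℝ] ℝ)
    (hjet : (τ, p, X) ∈ ParabolicSubjet O T (fun w => Ψ (u w, w.2)) (y₀, t₀)) :
    (φt (Ψ (u (y₀, t₀), t₀), t₀) + φr (Ψ (u (y₀, t₀), t₀), t₀) * τ,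
      φr (Ψ (u (y₀, t₀), t₀), t₀) • p,
      φrr (Ψ (u (y₀, t₀), t₀), t₀) • p.smulRight p
        + φr (Ψ (u (y₀, t₀), t₀), t₀) • X)
      ∈ ParabolicSubjet O T u (y₀, t₀) := by
  obtain ⟨ψ, ψt, Dψ, D2ψ, hψt, hDψ, hD2ψ, hψtc, hDψc, hD2ψc, hmax, hj⟩ := hjet
  obtain ⟨hj1, hj2, hj3⟩ : -τ = ψt (y₀, t₀) ∧ -p = Dψ (y₀, t₀) ∧ -X = D2ψ (y₀, t₀) := by
    simpa using hj
  have hopen : IsOpen (O ×ˢ Ioo (0 : ℝ) T) := hO.prod isOpen_Ioo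
  have hopen' : IsOpen ((univ : Set ℝ) ×ˢ Ioo (0 : ℝ) T) := isOpen_univ.prod isOpen_Ioo
  have hsub : (univ : Set ℝ) ×ˢ Ioo (0 : ℝ) T ⊆ univ ×ˢ Ico 0 T :=
    prod_mono_right Ioo_subset_Ico_self
  set c : ℝ := Ψ (u (y₀, t₀), t₀) + ψ (y₀, t₀) with hc
  have hψc : ContinuousOn ψ (O ×ˢ Ioo 0 T) := fun w hw =>
    (hasStrictFDerivAt_of_space_time
      (Filter.mem_of_superset (hopen.mem_nhds hw) hDψ)
      (Filter.mem_of_superset (hopen.mem_nhds hw) hψt)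
      (hDψc.continuousAt (hopen.mem_nhds hw))
      (hψtc.continuousAt (hopen.mem_nhds hw))).continuousAt.continuousWithinAt
  have hgc : ContinuousOn (fun w : EuclideanSpace ℝ (Fin n) × ℝ => (c - ψ w, w.2))
      (O ×ˢ Ioo 0 T) := (continuousOn_const.sub hψc).prodMk continuousOn_snd
  have hmaps : MapsTo (fun w : EuclideanSpace ℝ (Fin n) × ℝ => (c - ψ w, w.2))
      (O ×ˢ Ioo 0 T) (univ ×ˢ Ico 0 T) := fun w hw => ⟨mem_univ _, Ioo_subset_Ico_self hw.2⟩
  have hcz : c - ψ (y₀, t₀) = Ψ (u (y₀, t₀), t₀) := by rw [hc]; ring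
  refine ⟨fun w => -φ (c - ψ w, w.2),
    fun w => -(φr (c - ψ w, w.2) * -ψt w + φt (c - ψ w, w.2)),
    fun w => φr (c - ψ w, w.2) • Dψ w,
    fun w => φr (c - ψ w, w.2) • D2ψ w + (-(φrr (c - ψ w, w.2) • Dψ w)).smulRight (Dψ w),
    ?_, ?_, ?_, ?_, ?_, ?_, ?_, ?_⟩
  · intro w hw
    have hmem : (univ : Set ℝ) ×ˢ Ioo (0 : ℝ) T ∈ 𝓝 (c - ψ w, w.2) :=
      hopen'.mem_nhds ⟨mem_univ _, hw.2⟩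
    refine (hasDerivAt_comp_space_time (φ := φ) (φr := φr) (φt := φt)
      (g := fun s => c - ψ (w.1, s)) ?_ ?_
      ((hφrc.mono hsub).continuousAt hmem) ((hφtc.mono hsub).continuousAt hmem)
      ((hψt w hw).const_sub c)).neg
    · exact Filter.mem_of_superset hmem fun v hv => hφr v.1 v.2 (Ioo_subset_Ico_self hv.2)
    · exact Filter.mem_of_superset hmem fun v hv =>
        (hφt v.1 v.2 (Ioo_subset_Ico_self hv.2)).hasDerivAt (Ico_mem_nhds hv.2.1 hv.2.2)
  · intro w hw
    have h := ((hφr (c - ψ w) w.2 (Ioo_subset_Ico_self hw.2)).comp_hasFDerivAt_of_eq w.1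
      ((hDψ w hw).const_sub c) rfl).neg
    refine h.congr_fderiv ?_
    simp
  · intro w hw
    have h := ((hφrr (c - ψ w) w.2 (Ioo_subset_Ico_self hw.2)).comp_hasFDerivAt_of_eq w.1
      ((hDψ w hw).const_sub c) rfl).smul (hD2ψ w hw)
    refine h.congr_fderiv ?_
    simp
  · exact (((hφrc.comp hgc hmaps).mul hψtc.neg).add (hφtc.comp hgc hmaps)).neg
  · exact (hφrc.comp hgc hmaps).smul hDψc
  · have h₁ := (hφrc.comp hgc hmaps).smul hD2ψc
    have h₂ := ((ContinuousLinearMap.smulRightL ℝ (EuclideanSpace ℝ (Fin n))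
      (EuclideanSpace ℝ (Fin n) →L[ℝ] ℝ)).continuous.comp_continuousOn
        ((hφrrc.comp hgc hmaps).smul hDψc).neg).clm_apply hDψc
    have := (ContinuousLinearMap.topologicalAddGroup (σ := RingHom.id ℝ)
      (E := EuclideanSpace ℝ (Fin n)) (F := EuclideanSpace ℝ (Fin n) →L[ℝ] ℝ)).toContinuousAdd
    exact h₁.add h₂
  · filter_upwards [hmax, hopen.mem_nhds (⟨hy₀, ht₀⟩ : (y₀, t₀) ∈ O ×ˢ Ioo 0 T)]
      with w hw hwO
    have hmonoφ : Monotone fun ρ => φ (ρ, w.2) :=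
      monotone_of_hasDerivAt_nonneg (fun ρ => hφr ρ w.2 (Ioo_subset_Ico_self hwO.2))
        fun ρ => hmono ρ w.2 (Ioo_subset_Ico_self hwO.2)
    have hle : c - ψ w ≤ Ψ (u w, w.2) := by
      linarith
    have h₁ := hmonoφ hle
    have h₂ := hinv w.1 hwO.1 w.2 hwO.2
    have h₃ := hinv y₀ hy₀ t₀ ht₀
    simp only [hcz, Prod.mk.eta] at h₁ h₂ h₃ ⊢
    linarith
  · simp only [hcz, ← hj1, ← hj2, ← hj3, Prod.mk.injEq]
    refine ⟨by ring, by simp, ?_⟩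
    ext x y
    simp
    ring
end

section
/- Let O ⊆ ℝⁿ be open, T > 0, and u : O × (0,T) → ℝ be continuous. Let φ : ℝ × [0,T) → ℝ be C^{2,1} with ∂_r φ ≥ 0 (derivative in the first variable), and let Ψ : ℝ × [0,T) → ℝ be continuous and satisfy φ(Ψ(u(y,t),t),t) = u(y,t) for all (y,t) ∈ O × (0,T) and Ψ(φ(r,t),t) = r for all r in the range of Ψ(u(·,t),t). If (τ, p, X) belongs to the closure P̄^{2,−} of the subjet of the function (y,t) ↦ Ψ(u(y,t),t) at a point (y₀,t₀) ∈ O × (0,T), then (φ_t + φ′τ, φ′p, φ″ p⊗p + φ′X) ∈ P̄^{2,−} u(y₀,t₀), where φ_t, φ′, φ″ denote the t-derivative and the first and second derivatives of φ in its first variable, all evaluated at (Ψ(u(y₀,t₀),t₀), t₀). -/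
open Set Filter Topology

/-- The closure `P̄^{2,-} u (z)` of the parabolic subjet: all `(τ,p,X)` which are
limits of jets `(τⱼ,pⱼ,Xⱼ) ∈ P^{2,-} u (zⱼ)` at points `zⱼ ∈ O × (0,T)` with
`zⱼ → z` and `u(zⱼ) → u(z)`. -/
def ParabolicSubjetClosure {n : ℕ} (O : Set (EuclideanSpace ℝ (Fin n))) (T : ℝ)
    (u : EuclideanSpace ℝ (Fin n) × ℝ → ℝ) (z : EuclideanSpace ℝ (Fin n) × ℝ) :
    Set (ℝ × (EuclideanSpace ℝ (Fin n) →L[ℝ] ℝ) ×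
      (EuclideanSpace ℝ (Fin n) →L[ℝ] EuclideanSpace ℝ (Fin n) →L[ℝ] ℝ)) :=
  {j | ∃ (zs : ℕ → EuclideanSpace ℝ (Fin n) × ℝ)
      (js : ℕ → ℝ × (EuclideanSpace ℝ (Fin n) →L[ℝ] ℝ) ×
        (EuclideanSpace ℝ (Fin n) →L[ℝ] EuclideanSpace ℝ (Fin n) →L[ℝ] ℝ)),
    (∀ k, zs k ∈ O ×ˢ Ioo (0 : ℝ) T) ∧
    (∀ k, js k ∈ ParabolicSubjet O T u (zs k)) ∧
    Filter.Tendsto zs Filter.atTop (nhds z) ∧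
    Filter.Tendsto (fun k => u (zs k)) Filter.atTop (nhds (u z)) ∧
    Filter.Tendsto js Filter.atTop (nhds j)}

/-- A function of two variables whose partial derivatives exist near a point and are continuous
there has a (total) Fréchet derivative at that point, assembled from the partial ones. -/
theorem hasFDerivAt_of_continuousOn_partial {E : Type*} [NormedAddCommGroup E] [NormedSpace ℝ E]
    {U : Set (E × ℝ)} (hU : IsOpen U) {f ft : E × ℝ → ℝ} {Df : E × ℝ → E →L[ℝ] ℝ}
    (hft : ∀ w ∈ U, HasDerivAt (fun s => f (w.1, s)) (ft w) w.2)
    (hDf : ∀ w ∈ U, HasFDerivAt (fun x => f (x, w.2)) (Df w) w.1)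
    (hftc : ContinuousOn ft U) (hDfc : ContinuousOn Df U) {w : E × ℝ} (hw : w ∈ U) :
    HasFDerivAt f ((Df w).coprod (ContinuousLinearMap.toSpanSingleton ℝ (ft w))) w := by
  have hUw : U ∈ 𝓝 w := hU.mem_nhds hw
  refine (hasStrictFDerivAt_uncurry_coprod (u := w) (f := fun x t => f (x, t))
    (f₁ := fun x t => Df (x, t))
    (f₂ := fun x t => ContinuousLinearMap.toSpanSingleton ℝ (ft (x, t))) ?_ ?_ ?_ ?_).hasFDerivAt
  · filter_upwards [hUw] with v hv using hDf v hv
  · filter_upwards [hUw] with v hv using (hft v hv).hasFDerivAt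
  · exact hDfc.continuousAt hUw
  · exact (ContinuousLinearMap.toSpanSingletonCLE (𝕜 := ℝ) (E := ℝ)).continuous.continuousAt.comp
      (hftc.continuousAt hUw)

set_option maxSynthPendingDepth 6 in
/-- The subjet consists of the derivatives of test functions touching from below. -/
theorem mem_parabolicSubjet_iff {n : ℕ} {O : Set (EuclideanSpace ℝ (Fin n))} {T : ℝ}
    {u : EuclideanSpace ℝ (Fin n) × ℝ → ℝ} {z : EuclideanSpace ℝ (Fin n) × ℝ}
    {j : ℝ × (EuclideanSpace ℝ (Fin n) →L[ℝ] ℝ) ×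
      (EuclideanSpace ℝ (Fin n) →L[ℝ] EuclideanSpace ℝ (Fin n) →L[ℝ] ℝ)} :
    j ∈ ParabolicSubjet O T u z ↔
      ∃ (ψ ψt : EuclideanSpace ℝ (Fin n) × ℝ → ℝ)
        (Dψ : EuclideanSpace ℝ (Fin n) × ℝ → (EuclideanSpace ℝ (Fin n) →L[ℝ] ℝ))
        (D2ψ : EuclideanSpace ℝ (Fin n) × ℝ →
          (EuclideanSpace ℝ (Fin n) →L[ℝ] EuclideanSpace ℝ (Fin n) →L[ℝ] ℝ)),
      (∀ w ∈ O ×ˢ Ioo (0 : ℝ) T, HasDerivAt (fun s => ψ (w.1, s)) (ψt w) w.2) ∧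
      (∀ w ∈ O ×ˢ Ioo (0 : ℝ) T, HasFDerivAt (fun x => ψ (x, w.2)) (Dψ w) w.1) ∧
      (∀ w ∈ O ×ˢ Ioo (0 : ℝ) T, HasFDerivAt (fun x => Dψ (x, w.2)) (D2ψ w) w.1) ∧
      ContinuousOn ψt (O ×ˢ Ioo (0 : ℝ) T) ∧
      ContinuousOn Dψ (O ×ˢ Ioo (0 : ℝ) T) ∧
      ContinuousOn D2ψ (O ×ˢ Ioo (0 : ℝ) T) ∧
      IsLocalMin (fun w => u w - ψ w) z ∧
      j = (ψt z, Dψ z, D2ψ z) := by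
  constructor
  · rintro ⟨ψ, ψt, Dψ, D2ψ, h1, h2, h3, c1, c2, c3, hmax, hj⟩
    refine ⟨-ψ, -ψt, -Dψ, -D2ψ, fun w hw => (h1 w hw).neg, fun w hw => (h2 w hw).neg,
      fun w hw => (h3 w hw).neg, c1.neg, c2.neg, c3.neg, ?_, ?_⟩
    · filter_upwards [hmax] with w hw
      simp only [Pi.neg_apply] at hw ⊢
      linarith
    · obtain ⟨τ, p, X⟩ := j
      simp only [Prod.mk.injEq] at hj ⊢
      exact ⟨by simp [← hj.1], by simp [← hj.2.1], by simp [← hj.2.2]⟩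
  · rintro ⟨ψ, ψt, Dψ, D2ψ, h1, h2, h3, c1, c2, c3, hmin, rfl⟩
    refine ⟨-ψ, -ψt, -Dψ, -D2ψ, fun w hw => (h1 w hw).neg, fun w hw => (h2 w hw).neg,
      fun w hw => (h3 w hw).neg, c1.neg, c2.neg, c3.neg, ?_, rfl⟩
    filter_upwards [hmin] with w hw
    simp only [Pi.neg_apply] at hw ⊢
    linarith

/-- Chain rule for subjets under composition with a `C^{2,1}` function that is nondecreasing in
its first variable. -/
theorem parabolicSubjet_comp_monotone {n : ℕ} {O : Set (EuclideanSpace ℝ (Fin n))}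
    (hO : IsOpen O) {T : ℝ} {u v : EuclideanSpace ℝ (Fin n) × ℝ → ℝ} {φ φt φr φrr : ℝ × ℝ → ℝ}
    (hφt : ∀ q ∈ univ ×ˢ Ioo (0 : ℝ) T, HasDerivAt (fun s => φ (q.1, s)) (φt q) q.2)
    (hφr : ∀ q ∈ univ ×ˢ Ioo (0 : ℝ) T, HasDerivAt (fun ρ => φ (ρ, q.2)) (φr q) q.1)
    (hφrr : ∀ q ∈ univ ×ˢ Ioo (0 : ℝ) T, HasDerivAt (fun ρ => φr (ρ, q.2)) (φrr q) q.1)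
    (hφtc : ContinuousOn φt (univ ×ˢ Ioo 0 T))
    (hφrc : ContinuousOn φr (univ ×ˢ Ioo 0 T))
    (hφrrc : ContinuousOn φrr (univ ×ˢ Ioo 0 T))
    (hmono : ∀ q ∈ univ ×ˢ Ioo (0 : ℝ) T, 0 ≤ φr q)
    (huv : ∀ w ∈ O ×ˢ Ioo (0 : ℝ) T, φ (v w, w.2) = u w)
    {z : EuclideanSpace ℝ (Fin n) × ℝ} (hz : z ∈ O ×ˢ Ioo (0 : ℝ) T)
    {j : ℝ × (EuclideanSpace ℝ (Fin n) →L[ℝ] ℝ) ×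
      (EuclideanSpace ℝ (Fin n) →L[ℝ] EuclideanSpace ℝ (Fin n) →L[ℝ] ℝ)}
    (hj : j ∈ ParabolicSubjet O T v z) :
    (φt (v z, z.2) + φr (v z, z.2) * j.1, φr (v z, z.2) • j.2.1,
      φrr (v z, z.2) • j.2.1.smulRight j.2.1 + φr (v z, z.2) • j.2.2)
      ∈ ParabolicSubjet O T u z := by
  obtain ⟨ψ, ψt, Dψ, D2ψ, h1, h2, h3, c1, c2, c3, hmin, rfl⟩ := mem_parabolicSubjet_iff.1 hj
  have hU : IsOpen (O ×ˢ Ioo (0 : ℝ) T) := hO.prod isOpen_Ioo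
  have hψc : ContinuousOn ψ (O ×ˢ Ioo (0 : ℝ) T) := fun w hw =>
    (hasFDerivAt_of_continuousOn_partial hU h1 h2 c1 c2 hw).continuousAt.continuousWithinAt
  set g : EuclideanSpace ℝ (Fin n) × ℝ → ℝ × ℝ := fun w => (ψ w + (v z - ψ z), w.2) with hg
  have hgz : g z = (v z, z.2) := by simp [hg]
  have hgm : MapsTo g (O ×ˢ Ioo (0 : ℝ) T) (univ ×ˢ Ioo (0 : ℝ) T) := fun w hw =>
    ⟨mem_univ _, hw.2⟩
  have hgc : ContinuousOn g (O ×ˢ Ioo (0 : ℝ) T) :=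
    (hψc.add continuousOn_const).prodMk continuousOn_snd
  have hφD := fun q (hq : q ∈ univ ×ˢ Ioo (0 : ℝ) T) =>
    hasFDerivAt_of_continuousOn_partial (isOpen_univ.prod isOpen_Ioo) hφt
      (Df := fun q => ContinuousLinearMap.toSpanSingleton ℝ (φr q))
      (fun q hq => (hφr q hq).hasFDerivAt) hφtc
      ((ContinuousLinearMap.toSpanSingletonCLE (𝕜 := ℝ) (E := ℝ)).continuous.comp_continuousOn
        hφrc) hq
  refine mem_parabolicSubjet_iff.2 ⟨fun w => φ (g w), fun w => φt (g w) + φr (g w) * ψt w,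
    fun w => φr (g w) • Dψ w,
    fun w => φrr (g w) • (Dψ w).smulRight (Dψ w) + φr (g w) • D2ψ w, ?_, ?_, ?_, ?_, ?_, ?_, ?_, ?_⟩
  · intro w hw
    have hgd : HasDerivAt (fun s => g (w.1, s)) (ψt w, 1) w.2 :=
      ((h1 w hw).add_const _).prodMk (hasDerivAt_id _)
    have := (hφD (g w) (hgm hw)).comp_hasDerivAt (f := fun s => g (w.1, s)) w.2 hgd
    refine this.congr_deriv ?_
    simp
    ring
  · intro w hw
    exact (hφr (g w) (hgm hw)).comp_hasFDerivAt w.1 ((h2 w hw).add_const _)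
  · intro w hw
    have := ((hφrr (g w) (hgm hw)).comp_hasFDerivAt w.1 ((h2 w hw).add_const _)).smul (h3 w hw)
    refine this.congr_fderiv ?_
    ext a b
    simp [hg]
    ring
  · exact (hφtc.comp hgc hgm).add ((hφrc.comp hgc hgm).mul c1)
  · exact (hφrc.comp hgc hgm).smul c2
  · exact ((hφrrc.comp hgc hgm).smul
      (isBoundedBilinearMap_smulRight.continuous.comp_continuousOn (c2.prodMk c2))).add
      ((hφrc.comp hgc hgm).smul c3)
  · filter_upwards [hmin, hU.mem_nhds hz] with w hw hwU
    have hmonow : Monotone fun ρ => φ (ρ, w.2) :=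
      monotone_of_hasDerivAt_nonneg (fun ρ => hφr (ρ, w.2) ⟨mem_univ _, hwU.2⟩)
        fun ρ => hmono (ρ, w.2) ⟨mem_univ _, hwU.2⟩
    have hle : φ (g w) ≤ φ (v w, w.2) := hmonow (by linarith)
    rw [huv w hwU] at hle
    simp only [hgz, huv z hz]
    linarith
  · simp only [hgz]

/-- Let `O ⊆ ℝⁿ` be open, `T > 0`, `u` continuous on `O × (0,T)`.
Let `φ : ℝ × [0,T) → ℝ` be `C^{2,1}` with `∂ᵣφ ≥ 0`, and `Ψ` satisfy
`φ(Ψ(u(y,t),t),t) = u(y,t)` on `O × (0,T)` and `Ψ(φ(r,t),t) = r` for `r` in the range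
of `Ψ(u(·,t),t)`.  Assume moreover `Ψ` is continuous.
If `(τ,p,X) ∈ P̄^{2,-}` of `(y,t) ↦ Ψ(u(y,t),t)` at
`(y₀,t₀) ∈ O × (0,T)`, then
`(φₜ + φ′τ, φ′p, φ″ p⊗p + φ′X) ∈ P̄^{2,-} u (y₀,t₀)`, derivatives of `φ` evaluated at
`(Ψ(u(y₀,t₀),t₀), t₀)`. -/
theorem subjetClosure_comp_increasing (n : ℕ)
    (O : Set (EuclideanSpace ℝ (Fin n))) (hO : IsOpen O) (T : ℝ) (hT : 0 < T)
    (u : EuclideanSpace ℝ (Fin n) × ℝ → ℝ) (hu : ContinuousOn u (O ×ˢ Ioo 0 T))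
    (φ φt φr φrr : ℝ × ℝ → ℝ) (Ψ : ℝ × ℝ → ℝ)
    (hφt : ∀ r : ℝ, ∀ t ∈ Ico (0 : ℝ) T,
      HasDerivWithinAt (fun s => φ (r, s)) (φt (r, t)) (Ico 0 T) t)
    (hφr : ∀ r : ℝ, ∀ t ∈ Ico (0 : ℝ) T, HasDerivAt (fun ρ => φ (ρ, t)) (φr (r, t)) r)
    (hφrr : ∀ r : ℝ, ∀ t ∈ Ico (0 : ℝ) T, HasDerivAt (fun ρ => φr (ρ, t)) (φrr (r, t)) r)
    (hφc : ContinuousOn φ (univ ×ˢ Ico 0 T))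
    (hφtc : ContinuousOn φt (univ ×ˢ Ico 0 T))
    (hφrc : ContinuousOn φr (univ ×ˢ Ico 0 T))
    (hφrrc : ContinuousOn φrr (univ ×ˢ Ico 0 T))
    (hmono : ∀ r : ℝ, ∀ t ∈ Ico (0 : ℝ) T, 0 ≤ φr (r, t))
    (hinv : ∀ y ∈ O, ∀ t ∈ Ioo (0 : ℝ) T, φ (Ψ (u (y, t), t), t) = u (y, t))
    (hΨc : ContinuousOn Ψ (univ ×ˢ Ico 0 T))
    (hinv' : ∀ t ∈ Ioo (0 : ℝ) T, ∀ r : ℝ,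
      (∃ y ∈ O, r = Ψ (u (y, t), t)) → Ψ (φ (r, t), t) = r)
    (y₀ : EuclideanSpace ℝ (Fin n)) (t₀ : ℝ) (hy₀ : y₀ ∈ O) (ht₀ : t₀ ∈ Ioo 0 T)
    (τ : ℝ) (p : EuclideanSpace ℝ (Fin n) →L[ℝ] ℝ)
    (X : EuclideanSpace ℝ (Fin n) →L[ℝ] EuclideanSpace ℝ (Fin n) →L[ℝ] ℝ)
    (hjet : (τ, p, X) ∈ ParabolicSubjetClosure O T (fun w => Ψ (u w, w.2)) (y₀, t₀)) :
    (φt (Ψ (u (y₀, t₀), t₀), t₀) + φr (Ψ (u (y₀, t₀), t₀), t₀) * τ,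
      φr (Ψ (u (y₀, t₀), t₀), t₀) • p,
      φrr (Ψ (u (y₀, t₀), t₀), t₀) • p.smulRight p
        + φr (Ψ (u (y₀, t₀), t₀), t₀) • X)
      ∈ ParabolicSubjetClosure O T u (y₀, t₀) := by
  obtain ⟨zs, js, hzs, hjs, hzlim, hvlim, hjlim⟩ := hjet
  have hsub : (univ : Set ℝ) ×ˢ Ioo (0 : ℝ) T ⊆ univ ×ˢ Ico 0 T :=
    prod_mono_right Ioo_subset_Ico_self
  have hq₀ : (univ : Set ℝ) ×ˢ Ico (0 : ℝ) T ∈ 𝓝 (Ψ (u (y₀, t₀), t₀), t₀) :=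
    prod_mem_nhds univ_mem (Ico_mem_nhds ht₀.1 ht₀.2)
  have hqlim : Tendsto (fun k => (Ψ (u (zs k), (zs k).2), (zs k).2)) atTop
      (𝓝 (Ψ (u (y₀, t₀), t₀), t₀)) :=
    hvlim.prodMk_nhds ((continuous_snd.tendsto _).comp hzlim)
  have hlim : ∀ f : ℝ × ℝ → ℝ, ContinuousOn f (univ ×ˢ Ico 0 T) →
      Tendsto (fun k => f (Ψ (u (zs k), (zs k).2), (zs k).2)) atTop
        (𝓝 (f (Ψ (u (y₀, t₀), t₀), t₀))) :=
    fun f hf => (hf.continuousAt hq₀).tendsto.comp hqlim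
  have hp : Tendsto (fun k => (js k).2.1) atTop (𝓝 p) := hjlim.snd_nhds.fst_nhds
  refine ⟨zs, _, hzs, fun k => parabolicSubjet_comp_monotone hO (v := fun w => Ψ (u w, w.2))
    (fun q hq => (hφt q.1 q.2 (hsub hq).2).hasDerivAt (Ico_mem_nhds hq.2.1 hq.2.2))
    (fun q hq => hφr q.1 q.2 (hsub hq).2) (fun q hq => hφrr q.1 q.2 (hsub hq).2)
    (hφtc.mono hsub) (hφrc.mono hsub) (hφrrc.mono hsub) (fun q hq => hmono q.1 q.2 (hsub hq).2)
    (fun w hw => hinv w.1 hw.1 w.2 hw.2) (hzs k) (hjs k), hzlim, ?_, ?_⟩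
  · exact (hu.continuousAt ((hO.prod isOpen_Ioo).mem_nhds ⟨hy₀, ht₀⟩)).tendsto.comp hzlim
  · exact ((hlim φt hφtc).add ((hlim φr hφrc).mul hjlim.fst_nhds)).prodMk_nhds
      (((hlim φr hφrc).smul hp).prodMk_nhds
        (((hlim φrr hφrrc).smul
          ((isBoundedBilinearMap_smulRight.continuous.tendsto (p, p)).comp (hp.prodMk_nhds hp))).add
          ((hlim φr hφrc).smul hjlim.snd_nhds.snd_nhds)))
end
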